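/- arXiv:1606.01278 — 7 statements merged into one kernel-verified Lean document; each statement's English description precedes it below -/
import Mathlib

section
/- Let k be a field of characteristic zero, let A = k[x_0, …, x_n], let m = (x_0, …, x_n) be the irrelevant maximal ideal, and let I ⊆ A be a proper homogeneous ideal of height r all of whose minimal primes have height r. Suppose that for every prime ideal p of A with I ⊆ p and p ≠ m, the extended ideal I·A_p of the localization A_p is generated by r elements. Then for every i > r, the local cohomology module H^i_I(A) is supported at m; that is, every element of H^i_I(A) is annihilated by some power of m. -/
/-- The height of an ideal: the infimum of the heights (in the poset of primes)
of the prime ideals containing it. -/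
noncomputable def idealHeight {A : Type} [CommRing A] (I : Ideal A) : ℕ∞ :=
  ⨅ p : {p : PrimeSpectrum A // I ≤ p.asIdeal}, Order.height p.1

section
open CategoryTheory Abelian Opposite

theorem HomologicalComplex.homologyMap_unop {ι V : Type*} [Category* V]
    [Limits.HasZeroMorphisms V] {c : ComplexShape ι} {K L : HomologicalComplex Vᵒᵖ c}
    (β : K ⟶ L) (i : ι) [K.HasHomology i] [L.HasHomology i] :
    (homologyMap β i).unop = (L.homologyUnop i).inv ≫
      homologyMap ((unopFunctor _ _).map β.op) i ≫ (K.homologyUnop i).hom := by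
  have h := congrArg Quiver.Hom.unop
    (homologyOp_hom_naturality ((unopFunctor _ _).map β.op) i)
  rw [Iso.eq_inv_comp]
  exact h

theorem CochainComplex.homologyπ_eq_zero_of_iCycles_eq {R : Type*} [Ring R]
    (K : CochainComplex (ModuleCat R) ℕ) {p : ℕ} (z : K.cycles (p + 1)) (h : K.X p)
    (hz : K.d p (p + 1) h = K.iCycles (p + 1) z) :
    K.homologyπ (p + 1) z = 0 := by
  have hz' : z = K.toCycles p (p + 1) h := by
    apply (ModuleCat.mono_iff_injective (K.iCycles (p + 1))).mp inferInstance
    rw [← hz]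
    exact (ConcreteCategory.congr_hom (K.toCycles_i p (p + 1)) h).symm
  rw [hz']
  exact ConcreteCategory.congr_hom (K.toCycles_comp_homologyπ p (p + 1)) h

section
variable {R : Type*} [Ring R] {C : Type*} [Category* C] [Abelian C] [Linear R C]
  [EnoughProjectives C]

theorem Ext_map_app_eq {X X' : C} (g : X' ⟶ X) (P' : ProjectiveResolution X')
    (P : ProjectiveResolution X) (φ : ProjectiveResolution.Hom P' P g) (n : ℕ) (Y : C) :
    ((_root_.Ext R C n).map g.op).app Y = (P.isoExt n Y).hom ≫
      HomologicalComplex.homologyMap ((HomologicalComplex.unopFunctor _ _).map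
        ((((linearYoneda R C).obj Y).rightOp.mapHomologicalComplex _).map φ.hom).op) n ≫
        (P'.isoExt n Y).inv := by
  have h1 := congrArg Quiver.Hom.unop (Functor.leftDerived_map_eq
    ((linearYoneda R C).obj Y).rightOp n g (P := P') (Q := P) φ.hom (by simp))
  refine h1.trans ?_
  rw [unop_comp, unop_comp]
  refine (congrArg (fun z => (_ ≫ z) ≫ _) (HomologicalComplex.homologyMap_unop
    ((((linearYoneda R C).obj Y).rightOp.mapHomologicalComplex _).map φ.hom) n)).trans ?_
  rfl

theorem exists_ext_of_Ext [HasExt C] {X Y : C} {p : ℕ}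
    (y : ((_root_.Ext R C (p + 1)).obj (op X)).obj Y) :
    ∃ ξ : Ext X Y (p + 1), ∀ (X' : C) (g : X' ⟶ X) (a : R),
      a • (Ext.mk₀ g).comp ξ (zero_add _) = 0 →
        a • ((_root_.Ext R C (p + 1)).map g.op).app Y y = 0 := by
  let P := projectiveResolution X
  let K := P.complex.linearYonedaObj R Y
  obtain ⟨z, hz⟩ := (ModuleCat.epi_iff_surjective
    (K.homologyπ (p + 1))).mp inferInstance
    ((P.isoExt (p + 1) Y).hom y)
  let f : P.complex.X (p + 1) ⟶ Y := K.iCycles (p + 1) z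
  have hf : P.complex.d (p + 2) (p + 1) ≫ f = 0 :=
    ConcreteCategory.congr_hom (K.iCycles_d (p + 1) (p + 2)) z
  refine ⟨P.extMk f (p + 2) rfl hf, fun X' g a h => ?_⟩
  let P' := projectiveResolution X'
  let φ : ProjectiveResolution.Hom P' P g := ⟨ProjectiveResolution.lift g P' P, by
    simpa using ProjectiveResolution.lift_commutes_zero g P' P⟩
  rw [ProjectiveResolution.mk₀_comp_extMk f _ rfl hf φ, Ext.smul_eq_comp_mk₀,
    ProjectiveResolution.extMk_comp_mk₀,
    ProjectiveResolution.extMk_eq_zero_iff _ _ _ _ _ p rfl] at h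
  obtain ⟨h, hh⟩ := h
  rw [Ext_map_app_eq g P' P φ]
  let K' := P'.complex.linearYonedaObj R Y
  let ψ : K ⟶ K' :=
    (HomologicalComplex.unopFunctor _ _).map
        ((((linearYoneda R C).obj Y).rightOp.mapHomologicalComplex _).map φ.hom).op
  change a • (P'.isoExt (p + 1) Y).inv (HomologicalComplex.homologyMap ψ (p + 1)
    ((P.isoExt (p + 1) Y).hom y)) = 0
  rw [← hz]
  have h1 : HomologicalComplex.homologyMap ψ (p + 1) (K.homologyπ (p + 1) z) =
      K'.homologyπ (p + 1) (HomologicalComplex.cyclesMap ψ (p + 1) z) :=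
    ConcreteCategory.congr_hom (HomologicalComplex.homologyπ_naturality ψ (p + 1)) z
  have h2 : K'.iCycles (p + 1) (HomologicalComplex.cyclesMap ψ (p + 1) z) =
      ψ.f (p + 1) f :=
    ConcreteCategory.congr_hom (HomologicalComplex.cyclesMap_i ψ (p + 1)) z
  have h3 := CochainComplex.homologyπ_eq_zero_of_iCycles_eq K'
    (a • HomologicalComplex.cyclesMap ψ (p + 1) z) h (by
      rw [map_smul, h2]
      refine hh.trans ?_
      rw [Linear.comp_smul, Category.comp_id]
      rfl)
  rw [map_smul] at h3
  rw [h1, ← map_smul, h3, map_zero]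

end

theorem LinearMap.exists_comp_rangeRestrict_eq {A L N P : Type*} [Ring A] [AddCommGroup L]
    [AddCommGroup N] [AddCommGroup P] [Module A L] [Module A N] [Module A P]
    (f : L →ₗ[A] N) (h : L →ₗ[A] P) (hfh : LinearMap.ker f ≤ LinearMap.ker h) :
    ∃ ψ : LinearMap.range f →ₗ[A] P, ψ ∘ₗ f.rangeRestrict = h := by
  refine ⟨(LinearMap.ker f).liftQ h hfh ∘ₗ f.quotKerEquivRange.symm.toLinearMap, ?_⟩
  ext l
  have : f.quotKerEquivRange.symm (f.rangeRestrict l) = Submodule.Quotient.mk l := by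
    rw [LinearEquiv.symm_apply_eq]
    rfl
  simp [this]

section
universe u
variable {A : Type u} [CommRing A]

/-- For `i > r` and `N` finitely generated and `J`-power torsion, every class in `Ext^i(N, M)` is
killed by pulling back along a surjection onto `N` from a module of the same kind. -/
def ExtEffaceableAbove (J : Ideal A) (r : ℕ) : Prop :=
  ∀ (N M : ModuleCat.{u} A) [Module.Finite A N], (∃ t, J ^ t ≤ Module.annihilator A N) →
    ∀ i, r < i → ∀ ξ : Ext N M i,
      ∃ (N' : ModuleCat.{u} A) (π : N' ⟶ N), Module.Finite A N' ∧
        (∃ t, J ^ t ≤ Module.annihilator A N') ∧ Function.Surjective π ∧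
          (Ext.mk₀ π).comp ξ (zero_add _) = 0

theorem extEffaceableAbove_bot : ExtEffaceableAbove (⊥ : Ideal A) 0 := by
  intro N M _ _ i hi ξ
  obtain ⟨n, f, hf⟩ := Module.Finite.exists_fin' A N
  obtain ⟨i, rfl⟩ := Nat.exists_eq_succ_of_ne_zero hi.ne'
  have : Projective (ModuleCat.of A (Fin n → A)) := inferInstance
  refine ⟨ModuleCat.of A (Fin n → A), ModuleCat.ofHom f,
    inferInstanceAs (Module.Finite A (Fin n → A)), ⟨1, by simp⟩, hf, Ext.eq_zero_of_projective _⟩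

theorem exists_ker_pow_smul_stable (g : A) (L : Type*) [AddCommGroup L] [Module A L]
    [IsNoetherian A L] : ∃ e : ℕ, ∀ c : ℕ, ∀ l : L, g ^ (e + c) • l = 0 → g ^ e • l = 0 := by
  obtain ⟨e, he⟩ := monotone_stabilizes_iff_noetherian.mpr ‹IsNoetherian A L›
    ⟨fun n => LinearMap.ker (LinearMap.lsmul A L (g ^ n)), by
      refine monotone_nat_of_le_succ fun n l hl => ?_
      simp only [LinearMap.mem_ker, LinearMap.lsmul_apply] at hl ⊢
      rw [pow_succ', mul_smul, hl, smul_zero]⟩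
  refine ⟨e, fun c l hl => ?_⟩
  have h := he (e + c) (Nat.le_add_right _ _)
  have : l ∈ LinearMap.ker (LinearMap.lsmul A L (g ^ (e + c))) := hl
  exact (SetLike.ext_iff.mp h l).mpr this

theorem ExtEffaceableAbove.sup_span_singleton [IsNoetherianRing A] {J : Ideal A} {r : ℕ}
    (hJ : ExtEffaceableAbove J r) (g : A) :
    ExtEffaceableAbove (J ⊔ Ideal.span {g}) (r + 1) := by
  intro N M _ ⟨c, hc⟩ i hi ξ
  obtain ⟨i, rfl⟩ := Nat.exists_eq_add_of_le' (Nat.one_le_of_lt hi)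
  obtain ⟨N', π, _, ⟨t, ht⟩, hπ, hξ⟩ := hJ N M
    ⟨c, (Ideal.pow_right_mono le_sup_left c).trans hc⟩ (i + 1) (by omega) ξ
  have hS := LinearMap.shortExact_shortComplexKer hπ
  obtain ⟨η, hη⟩ := Ext.contravariant_sequence_exact₃ hS M ξ hξ (add_comm 1 i)
  obtain ⟨K', κ, _, ⟨s, hs⟩, hκ, hη'⟩ := hJ (ModuleCat.of A (LinearMap.ker π.hom)) M
    ⟨t, fun a ha => Module.mem_annihilator.mpr fun x =>
      Subtype.ext (Module.mem_annihilator.mp (ht ha) x)⟩ i (by omega) η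
  have hgc (x : N) : g ^ c • x = 0 := Module.mem_annihilator.mp
    (hc (Ideal.pow_right_mono le_sup_right c
      (Ideal.pow_mem_pow (Ideal.mem_span_singleton_self g) c))) x
  let L : Submodule A (N' × K') := LinearMap.eqLocus
    (g ^ c • LinearMap.fst A N' K')
    ((LinearMap.ker π.hom).subtype ∘ₗ κ.hom ∘ₗ LinearMap.snd A N' K')
  have hL (l : L) : g ^ c • l.1.1 = (κ l.1.2).1 := l.2
  have hLfst (x : N') : ∃ l : L, l.1.1 = x := by
    obtain ⟨k, hk⟩ := hκ ⟨g ^ c • x, by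
      change π.hom _ = 0
      rw [map_smul]
      exact hgc _⟩
    exact ⟨⟨(x, k), congrArg Subtype.val hk.symm⟩, rfl⟩
  obtain ⟨e, he⟩ := exists_ker_pow_smul_stable g L
  let G (m : ℕ) : L →ₗ[A] L := LinearMap.lsmul A L (g ^ m)
  obtain ⟨ψ, hψ⟩ := LinearMap.exists_comp_rangeRestrict_eq (G (e + c))
    (LinearMap.snd A N' K' ∘ₗ L.subtype ∘ₗ G e) (fun l hl => by
      have := he c l hl
      change (G e l).1.2 = 0
      change G e l = 0 at this
      rw [this]
      rfl)
  let Q : Submodule A L := LinearMap.range (G (e + c))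
  let S₂ : ShortComplex (ModuleCat.{u} A) := ShortComplex.moduleCatMk (X₁ := Q) (X₂ := L)
    (X₃ := L ⧸ Q) Q.subtype Q.mkQ
    (LinearMap.ext fun x => (Submodule.Quotient.mk_eq_zero _).mpr x.2)
  have hS₂ : S₂.ShortExact := ModuleCat.shortComplex_shortExact _
    (LinearMap.exact_subtype_mkQ Q) Q.injective_subtype Q.mkQ_surjective
  let p : L →ₗ[A] N := π.hom ∘ₗ LinearMap.fst A N' K' ∘ₗ L.subtype
  have hp : Q ≤ LinearMap.ker p := by
    rintro _ ⟨l, rfl⟩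
    change p (g ^ (e + c) • l) = 0
    rw [map_smul, pow_add, mul_smul, hgc, smul_zero]
  let τ : S₂ ⟶ π.hom.shortComplexKer :=
    { τ₁ := ModuleCat.ofHom ψ ≫ κ
      τ₂ := ModuleCat.ofHom (LinearMap.fst A N' K' ∘ₗ L.subtype)
      τ₃ := ModuleCat.ofHom (Q.liftQ p hp)
      comm₁₂ := by
        ext ⟨_, l, rfl⟩
        change (κ (ψ ((G (e + c)).rangeRestrict l))).1 = (G (e + c) l).1.1
        have := LinearMap.congr_fun hψ l
        simp only [LinearMap.comp_apply] at this
        rw [this]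
        change (κ (G e l).1.2).1 = _
        rw [← hL]
        change g ^ c • g ^ e • l.1.1 = g ^ (e + c) • l.1.1
        rw [smul_smul, add_comm, pow_add]
      comm₂₃ := rfl }
  refine ⟨S₂.X₃, τ.τ₃, inferInstanceAs (Module.Finite A (L ⧸ Q)),
    ⟨max t s + (e + c), ?_⟩, ?_, ?_⟩
  · refine Ideal.sup_pow_add_le_pow_sup_pow.trans (sup_le ?_ ?_)
    · intro a ha
      refine Module.mem_annihilator.mpr fun x => ?_
      obtain ⟨l, rfl⟩ := Q.mkQ_surjective x
      have : a • l = 0 := Subtype.ext <| Prod.ext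
        (Module.mem_annihilator.mp (ht (Ideal.pow_le_pow_right (le_max_left _ _) ha)) _)
        (Module.mem_annihilator.mp (hs (Ideal.pow_le_pow_right (le_max_right _ _) ha)) _)
      exact (Q.mkQ.map_smul a l).symm.trans ((congrArg Q.mkQ this).trans (map_zero _))
    · rw [Ideal.span_singleton_pow, Ideal.span_singleton_le_iff_mem]
      refine Module.mem_annihilator.mpr fun x => ?_
      obtain ⟨l, rfl⟩ := Q.mkQ_surjective x
      exact (Q.mkQ.map_smul _ l).symm.trans
        ((Submodule.Quotient.mk_eq_zero _).mpr ⟨l, rfl⟩)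
  · intro x
    obtain ⟨y, rfl⟩ := hπ x
    obtain ⟨l, rfl⟩ := hLfst y
    exact ⟨Q.mkQ l, rfl⟩
  · have hnat := ShortComplex.ShortExact.extClass_naturality hS₂ hS τ
    rw [← hη, ← Ext.comp_assoc (a₁₂ := 1) _ _ _ (by omega) (by omega) (by omega)]
    erw [← hnat]
    rw [Ext.comp_assoc_of_second_deg_zero]
    change hS₂.extClass.comp ((Ext.mk₀ (ModuleCat.ofHom ψ ≫ κ)).comp η _) _ = 0
    rw [← Ext.mk₀_comp_mk₀_assoc, hη', Ext.comp_zero]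
    exact hS₂.extClass.comp_zero _ _ _ _


theorem extEffaceableAbove_span_range [IsNoetherianRing A] {r : ℕ} (g : Fin r → A) :
    ExtEffaceableAbove (Ideal.span (Set.range g)) r := by
  induction r with
  | zero =>
    rw [Set.range_eq_empty, Ideal.span_empty]
    exact extEffaceableAbove_bot
  | succ r ih =>
    have := (ih (Fin.tail g)).sup_span_singleton (g 0)
    rwa [← Ideal.span_union, Set.union_singleton, ← Fin.range_cons, Fin.cons_self_tail] at this

theorem ExtEffaceableAbove.exists_pow_smul_comp_eq_zero {I J : Ideal A} {r : ℕ}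
    (hJ : ExtEffaceableAbove J r) (hJI : J ≤ I) {f : A} (hf : ∀ b ∈ I, f * b ∈ J) {t i : ℕ}
    (hi : r < i) {M : ModuleCat.{u} A} (ξ : Ext (ModuleCat.of A (A ⧸ I ^ t)) M i) :
    ∃ (T : ℕ) (hT : t ≤ T),
      f ^ T • (Ext.mk₀ (ModuleCat.ofHom (Submodule.factor (Ideal.pow_le_pow_right hT :
        I ^ T ≤ I ^ t)))).comp ξ (zero_add _) = 0 := by
  obtain ⟨i, rfl⟩ := Nat.exists_eq_add_of_le' (Nat.one_le_of_lt hi)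
  obtain ⟨N', π, _, ⟨t', ht'⟩, hπ, hξ⟩ := hJ _ M
    ⟨t, fun a ha => Module.mem_annihilator.mpr fun x => by
      obtain ⟨b, rfl⟩ := Ideal.Quotient.mk_surjective x
      exact Ideal.Quotient.eq_zero_iff_mem.mpr
        (Ideal.mul_mem_right _ _ (Ideal.pow_right_mono hJI t ha))⟩ (i + 1) hi ξ
  obtain ⟨n, hn⟩ := hπ (Submodule.Quotient.mk 1)
  let T := max t t'
  have hT : I ^ T ≤ I ^ t := Ideal.pow_le_pow_right (le_max_left _ _)
  have hJT : J ^ T ≤ I ^ T := Ideal.pow_right_mono hJI T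
  refine ⟨T, le_max_left _ _, ?_⟩
  let u : (A ⧸ J ^ T) →ₗ[A] N' := (J ^ T).liftQ (LinearMap.toSpanSingleton A N' n) fun a ha =>
    Module.mem_annihilator.mp (ht' (Ideal.pow_le_pow_right (le_max_right _ _) ha)) n
  let q : (A ⧸ J ^ T) →ₗ[A] A ⧸ I ^ T := Submodule.factor hJT
  have hq : Function.Surjective q := Submodule.factor_surjective hJT
  have hu : ModuleCat.ofHom q ≫ ModuleCat.ofHom (Submodule.factor hT) = ModuleCat.ofHom u ≫ π := by
    refine ModuleCat.hom_ext (LinearMap.ext fun x => ?_)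
    obtain ⟨a, rfl⟩ := Ideal.Quotient.mk_surjective x
    change Submodule.Quotient.mk a = π.hom (a • n)
    rw [map_smul]
    refine Eq.trans ?_ (congrArg (a • ·) hn).symm
    change Submodule.Quotient.mk a = Submodule.Quotient.mk (a • 1)
    rw [smul_eq_mul, mul_one]
  have hS := LinearMap.shortExact_shortComplexKer hq
  obtain ⟨η, hη⟩ := Ext.contravariant_sequence_exact₃ hS M
    ((Ext.mk₀ (ModuleCat.ofHom (Submodule.factor hT))).comp ξ (zero_add _)) (by
      change (Ext.mk₀ (ModuleCat.ofHom q)).comp _ _ = 0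
      rw [Ext.mk₀_comp_mk₀_assoc, hu, ← Ext.mk₀_comp_mk₀_assoc, hξ, Ext.comp_zero])
      (add_comm 1 i)
  have hfJ : ∀ b ∈ I ^ T, f ^ T * b ∈ J ^ T := fun b hb => by
    have : Ideal.span {f} * I ≤ J := Ideal.mul_le.mpr fun a ha b hb => by
      obtain ⟨c, rfl⟩ := Ideal.mem_span_singleton'.mp ha
      rw [mul_assoc]
      exact J.mul_mem_left _ (hf b hb)
    have := Ideal.pow_right_mono this T
    rw [mul_pow] at this
    exact this (Ideal.mul_mem_mul (Ideal.pow_mem_pow (Ideal.mem_span_singleton_self f) T) hb)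
  have hK : f ^ T • 𝟙 q.shortComplexKer.X₁ = 0 := by
    refine ModuleCat.hom_ext (LinearMap.ext fun (x : LinearMap.ker q) => ?_)
    obtain ⟨b, hb⟩ := Ideal.Quotient.mk_surjective x.1
    have hx : q x.1 = 0 := x.2
    rw [← hb] at hx
    refine Subtype.ext (?_ : f ^ T • x.1 = 0)
    rw [← hb]
    exact (Ideal.Quotient.eq_zero_iff_mem.mpr
      (hfJ b (Ideal.Quotient.eq_zero_iff_mem.mp hx)))
  have hfη : f ^ T • η = 0 := by
    rw [← Ext.mk₀_id_comp η, ← Ext.smul_comp, ← Ext.mk₀_smul, hK, Ext.mk₀_zero, Ext.zero_comp]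
  change f ^ T • (Ext.mk₀ (ModuleCat.ofHom (Submodule.factor hT))).comp ξ _ = 0
  rw [← hη, ← Ext.comp_smul, hfη, Ext.comp_zero]

end

theorem exists_mul_mem_of_map_eq_span {A : Type*} [CommRing A] [IsNoetherianRing A] (I p : Ideal A)
    [p.IsPrime] {r : ℕ} (g : Fin r → Localization.AtPrime p)
    (hg : I.map (algebraMap A (Localization.AtPrime p)) = Ideal.span (Set.range g)) :
    ∃ a : Fin r → A, Ideal.span (Set.range a) ≤ I ∧
      ∃ f ∉ p, ∀ b ∈ I, f * b ∈ Ideal.span (Set.range a) := by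
  have hgI (j : Fin r) : g j ∈ I.map (algebraMap A (Localization.AtPrime p)) :=
    hg ▸ Ideal.subset_span ⟨j, rfl⟩
  choose a ha using fun j => (IsLocalization.mem_map_algebraMap_iff p.primeCompl _).mp (hgI j)
  let J := Ideal.span (Set.range fun j => (a j).1.1)
  have hJ : I.map (algebraMap A (Localization.AtPrime p)) ≤
      J.map (algebraMap A (Localization.AtPrime p)) := by
    rw [hg, Ideal.span_le]
    rintro _ ⟨j, rfl⟩
    exact (IsLocalization.mem_map_algebraMap_iff p.primeCompl _).mpr
      ⟨(⟨(a j).1.1, Ideal.subset_span ⟨j, rfl⟩⟩, (a j).2), ha j⟩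
  have hloc (b : A) (hb : b ∈ I) : ∃ s ∉ p, s * b ∈ J := by
    obtain ⟨⟨c, s⟩, h⟩ := (IsLocalization.mem_map_algebraMap_iff p.primeCompl _).mp
      (hJ (Ideal.mem_map_of_mem _ hb))
    rw [← map_mul, IsLocalization.eq_iff_exists p.primeCompl] at h
    obtain ⟨s', hs'⟩ := h
    refine ⟨s' * s, (s' * s).2, ?_⟩
    rw [mul_assoc, mul_comm (s : A), hs']
    exact J.mul_mem_left _ c.2
  refine ⟨fun j => (a j).1.1, Ideal.span_le.mpr (by rintro _ ⟨j, rfl⟩; exact (a j).1.2), ?_⟩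
  obtain ⟨S, hS⟩ := I.fg_of_isNoetherianRing
  choose! s hsp hs using hloc
  have hSI : ∀ b ∈ S, b ∈ I := fun b hb => hS ▸ Ideal.subset_span hb
  refine ⟨∏ b ∈ S, s b, ?_, fun b hb => ?_⟩
  · rw [Ideal.IsPrime.prod_mem_iff]
    push Not
    exact fun b hb => hsp b (hSI b hb)
  · suffices I ≤ Submodule.comap (LinearMap.mulLeft A (∏ b ∈ S, s b)) J from this hb
    rw [← hS, Submodule.span_le]
    intro b hb
    obtain ⟨c, hc⟩ := Finset.dvd_prod_of_mem s hb
    change _ * b ∈ J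
    rw [hc, mul_right_comm]
    exact J.mul_mem_right _ (hs b (hSI b hb))

theorem exists_pow_smul_eq_zero_of_forall_isPrime {A M : Type*} [CommRing A] [IsNoetherianRing A]
    [AddCommGroup M] [Module A M] (m : Ideal A) (x : M)
    (h : ∀ p : Ideal A, p.IsPrime → p ≠ m → ∃ f ∉ p, f • x = 0) :
    ∃ s : ℕ, ∀ a ∈ m ^ s, a • x = 0 := by
  have hle : m ≤ (Ideal.torsionOf A M x).radical := by
    rw [Ideal.radical_eq_sInf]
    refine le_sInf fun p ⟨hxp, hp⟩ => ?_
    by_cases hpm : p = m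
    · exact hpm.ge
    · obtain ⟨f, hfp, hf⟩ := h p hp hpm
      exact absurd (hxp hf) hfp
  obtain ⟨s, hs⟩ := Ideal.exists_pow_le_of_le_radical_of_fg hle m.fg_of_isNoetherianRing
  exact ⟨s, fun a ha => hs ha⟩

section
universe u

theorem localCohomology_exists_rep {A : Type u} [CommRing A] (I : Ideal A) (i : ℕ)
    (M : ModuleCat.{u} A) (x : (localCohomology I i).obj M) :
    ∃ (t : ℕ)
      (y : ((_root_.Ext A (ModuleCat.{u} A) i).obj (op (ModuleCat.of A (A ⧸ I ^ t)))).obj M),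
      ∀ (T : ℕ) (hT : t ≤ T) (a : A),
        a • ((_root_.Ext A (ModuleCat.{u} A) i).map (ModuleCat.ofHom (Submodule.factor
          (Ideal.pow_le_pow_right hT : I ^ T ≤ I ^ t))).op).app M y = 0 → a • x = 0 := by
  let D := localCohomology.diagram (localCohomology.idealPowersDiagram I) i
  have : Limits.HasColimit D := localCohomology.hasColimitDiagram _ i
  have := Limits.preservesSmallestFilteredColimits_of_preservesFilteredColimits
    (forget (ModuleCat.{u} A))
  obtain ⟨t, y, hy⟩ := Limits.Concrete.isColimit_exists_rep _
    (Limits.isColimitOfPreserves ((evaluation _ _).obj M) (Limits.colimit.isColimit D)) x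
  refine ⟨t.unop.unop, y, fun T hT a h => ?_⟩
  let w : t ⟶ op (op T) := (homOfLE hT).op.op
  let φ := ((Limits.colimit.ι D (op (op T))).app M).hom
  have hw : φ ((D.map w).app M y) = x :=
    (ConcreteCategory.congr_hom (congrArg (fun z => z.app M) (Limits.colimit.w D w)) y).trans hy
  exact (congrArg (a • ·) hw.symm).trans
    ((φ.map_smul a _).symm.trans ((congrArg φ h).trans φ.map_zero))

theorem exists_smul_localCohomology_eq_zero {A : Type u} [CommRing A] [IsNoetherianRing A]
    (I p : Ideal A) [p.IsPrime] {r i : ℕ} (hi : r < i)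
    (hp : I ≤ p → ∃ g : Fin r → Localization.AtPrime p,
      I.map (algebraMap A (Localization.AtPrime p)) = Ideal.span (Set.range g))
    (M : ModuleCat.{u} A) (x : (localCohomology I i).obj M) : ∃ f ∉ p, f • x = 0 := by
  obtain ⟨t, y, hy⟩ := localCohomology_exists_rep I i M x
  obtain ⟨i, rfl⟩ := Nat.exists_eq_add_of_le' (Nat.one_le_of_lt hi)
  obtain ⟨ξ, hξ⟩ := exists_ext_of_Ext y
  by_cases hIp : I ≤ p
  · obtain ⟨g, hg⟩ := hp hIp
    obtain ⟨a, haI, f, hf, hfI⟩ := exists_mul_mem_of_map_eq_span I p g hg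
    obtain ⟨T, hT, h⟩ := (extEffaceableAbove_span_range a).exists_pow_smul_comp_eq_zero
      haI hfI hi ξ
    exact ⟨f ^ T, fun h => hf (Ideal.IsPrime.mem_of_pow_mem ‹_› T h), hy T hT _ (hξ _ _ _ h)⟩
  · obtain ⟨a, haI, hap⟩ := SetLike.not_le_iff_exists.mp hIp
    refine ⟨a ^ t, fun h => hap (Ideal.IsPrime.mem_of_pow_mem ‹_› t h),
      hy t le_rfl _ (hξ _ _ _ ?_)⟩
    have h0 : a ^ t • ModuleCat.ofHom (Submodule.factor
        (Ideal.pow_le_pow_right le_rfl : I ^ t ≤ I ^ t)) = 0 := by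
      refine ModuleCat.hom_ext (LinearMap.ext fun x => ?_)
      obtain ⟨b, rfl⟩ := Ideal.Quotient.mk_surjective x
      exact Ideal.Quotient.eq_zero_iff_mem.mpr
        (Ideal.mul_mem_right _ _ (Ideal.pow_mem_pow haI t))
    rw [← Ext.smul_comp, ← Ext.mk₀_smul, h0, Ext.mk₀_zero, Ext.zero_comp]

end

end

/-- Let `k` be a field of characteristic zero, `A = k[x_0, …, x_n]`, `m = (x_0, …, x_n)` and
`I` a proper homogeneous ideal of height `r` all of whose minimal primes have height `r`.
If for every prime `p ⊇ I` with `p ≠ m` the extension of `I` to `A_p` is generated by `r`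
elements, then for every `i > r` every element of `H^i_I(A)` is annihilated by a power of `m`. -/
theorem localCohomology_supported_at_irrelevant_of_locally_r_generated
    {k : Type} [Field k] [CharZero k] (n : ℕ)
    (I : Ideal (MvPolynomial (Fin (n + 1)) k)) (hI : I ≠ ⊤)
    (hhom : ∀ f ∈ I, ∀ d : ℕ, MvPolynomial.homogeneousComponent d f ∈ I)
    (r : ℕ) (hht : idealHeight I = (r : ℕ∞))
    (hmin : ∀ p ∈ I.minimalPrimes, idealHeight p = (r : ℕ∞))
    (hloc : ∀ (p : Ideal (MvPolynomial (Fin (n + 1)) k)) [p.IsPrime], I ≤ p →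
      p ≠ Ideal.span (Set.range (MvPolynomial.X : Fin (n + 1) → MvPolynomial (Fin (n + 1)) k)) →
      ∃ g : Fin r → Localization.AtPrime p,
        Ideal.map (algebraMap (MvPolynomial (Fin (n + 1)) k) (Localization.AtPrime p)) I =
          Ideal.span (Set.range g))
    (i : ℕ) (hi : r < i)
    (x : (localCohomology I i).obj
      (ModuleCat.of (MvPolynomial (Fin (n + 1)) k) (MvPolynomial (Fin (n + 1)) k))) :
    ∃ s : ℕ, ∀ a ∈ (Ideal.span
        (Set.range (MvPolynomial.X : Fin (n + 1) → MvPolynomial (Fin (n + 1)) k))) ^ s,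
      a • x = 0 := by
  exact exists_pow_smul_eq_zero_of_forall_isPrime _ x fun p hp hpm =>
    exists_smul_localCohomology_eq_zero I p hi (fun hIp => hloc p hIp hpm) _ x
end

section
/- Let (A, m) be a commutative Noetherian local ring containing a field k that maps isomorphically onto the residue field A/m, and let E be an injective hull of k over A. Then for every A-module M there is a k-linear bijection between Hom_A(M, E) and the k-vector space of continuous k-linear maps from M to k, where a k-linear map ψ : M → k is called continuous if for every finitely generated A-submodule N ⊆ M there exists an integer s with ψ(m^s·N) = 0. -/
section

variable {k A M : Type} [Field k] [CommRing A]
  [AddCommGroup M] [Module A M]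

/-- `ψ : M → k` is `k`-linear, where `M` is viewed as a `k`-vector space via the
ring homomorphism `σ : k → A`. -/
def IsSigmaLinear (σ : k →+* A) (ψ : M → k) : Prop :=
  (∀ x y : M, ψ (x + y) = ψ x + ψ y) ∧ ∀ (c : k) (x : M), ψ (σ c • x) = c * ψ x

/-- `ψ : M → k` is continuous: for every finitely generated submodule `N ⊆ M` there is an
integer `s` with `ψ (m^s • N) = 0`, `m` being the maximal ideal of the local ring `A`. -/
def IsContinuousLinearForm (A : Type) [CommRing A] [IsLocalRing A] {k M : Type} [Zero k]
    [AddCommGroup M] [Module A M] (ψ : M → k) : Prop :=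
  ∀ N : Submodule A M, N.FG → ∃ s : ℕ,
    ∀ x ∈ (IsLocalRing.maximalIdeal A ^ s) • N, ψ x = 0

end

namespace IsSigmaLinear

variable {k A M N : Type} [Field k] [CommRing A] [AddCommGroup M] [Module A M]
  [AddCommGroup N] [Module A N] {σ : k →+* A} {χ : M → k}

lemma map_zero (h : IsSigmaLinear σ χ) : χ 0 = 0 := by
  simpa using h.1 0 0

lemma map_sub (h : IsSigmaLinear σ χ) (x y : M) : χ (x - y) = χ x - χ y := by
  have := h.1 (x - y) y
  rw [sub_add_cancel] at this
  rw [this, add_sub_cancel_right]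

lemma comp (h : IsSigmaLinear σ χ) (f : N →ₗ[A] M) : IsSigmaLinear σ fun x => χ (f x) :=
  ⟨fun x y => by simp only [_root_.map_add, h.1], fun c x => by simp only [_root_.map_smul, h.2]⟩

/-- The largest `A`-submodule on which the `k`-linear form `χ` vanishes. -/
def radical (h : IsSigmaLinear σ χ) : Submodule A M where
  carrier := {x | ∀ a : A, χ (a • x) = 0}
  add_mem' hx hy a := by rw [smul_add, h.1, hx a, hy a, add_zero]
  zero_mem' a := by rw [smul_zero, h.map_zero]
  smul_mem' b x hx a := by rw [smul_smul]; exact hx _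

lemma mem_radical (h : IsSigmaLinear σ χ) {x : M} :
    x ∈ h.radical ↔ ∀ a : A, χ (a • x) = 0 := Iff.rfl

variable [IsLocalRing A]

/-- If `k` surjects onto the residue field, an element of the kernel of `χ` whose multiples by the
maximal ideal lie in the radical of `χ` lies in the radical itself. -/
lemma mem_radical_of_apply_eq_zero (h : IsSigmaLinear σ χ)
    (hσ : Function.Surjective ((Ideal.Quotient.mk (IsLocalRing.maximalIdeal A)).comp σ)) {x : M}
    (hx : χ x = 0) (hm : ∀ b ∈ IsLocalRing.maximalIdeal A, b • x ∈ h.radical) :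
    x ∈ h.radical := by
  intro a
  obtain ⟨c, hc⟩ := hσ (Ideal.Quotient.mk _ a)
  have hac : a - σ c ∈ IsLocalRing.maximalIdeal A := Ideal.Quotient.eq.mp hc.symm
  have h1 := hm _ hac 1
  rw [one_smul, sub_smul, h.map_sub, h.2, hx, mul_zero, sub_zero] at h1
  exact h1

/-- If `x` is not in the radical of the form `χ`, which vanishes on some `m ^ s • x`, then `x` has
a multiple that is a nonzero socle element modulo the radical. -/
lemma exists_smul_notMem_radical (h : IsSigmaLinear σ χ) {x : M} (hx : x ∉ h.radical)
    (hs : ∃ s : ℕ, ∀ a ∈ IsLocalRing.maximalIdeal A ^ s, χ (a • x) = 0) :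
    ∃ a : A, a • x ∉ h.radical ∧
      ∀ b ∈ IsLocalRing.maximalIdeal A, b • a • x ∈ h.radical := by
  have hs' : ∃ s : ℕ, ∀ a ∈ IsLocalRing.maximalIdeal A ^ s, a • x ∈ h.radical := by
    obtain ⟨s, hs⟩ := hs
    refine ⟨s, fun a ha b => ?_⟩
    rw [smul_smul]
    exact hs _ (Ideal.mul_mem_left _ b ha)
  classical
  obtain ⟨s, hs, hmin⟩ : ∃ s : ℕ, (∀ a ∈ IsLocalRing.maximalIdeal A ^ s, a • x ∈ h.radical) ∧
      ∀ t < s, ¬ ∀ a ∈ IsLocalRing.maximalIdeal A ^ t, a • x ∈ h.radical :=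
    ⟨Nat.find hs', Nat.find_spec hs', fun t ht => Nat.find_min hs' ht⟩
  cases s with
  | zero => exact absurd (by simpa using hs 1 (by simp)) hx
  | succ t =>
    obtain ⟨a, ha, hax⟩ : ∃ a ∈ IsLocalRing.maximalIdeal A ^ t, a • x ∉ h.radical := by
      simpa using hmin t t.lt_succ_self
    refine ⟨a, hax, fun b hb => ?_⟩
    rw [smul_smul]
    exact hs _ (by rw [pow_succ']; exact Ideal.mul_mem_mul hb ha)

/-- An injective module embedded in `M` modulo the radical of a continuous form `χ`, and containing
a socle element on which `χ` does not vanish, exhausts `M` modulo the radical. -/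
lemma exists_sub_mem_radical (h : IsSigmaLinear σ χ)
    (hσ : Function.Surjective ((Ideal.Quotient.mk (IsLocalRing.maximalIdeal A)).comp σ))
    (hχ : ∀ x, ∃ s : ℕ, ∀ a ∈ IsLocalRing.maximalIdeal A ^ s, χ (a • x) = 0)
    [Module.Injective A N] (j : N →ₗ[A] M) (hj : ∀ y, j y ∈ h.radical → y = 0)
    (y₀ : N) (hy₀ : ∀ b ∈ IsLocalRing.maximalIdeal A, b • y₀ = 0) (hjy₀ : χ (j y₀) ≠ 0) :
    ∃ r : M →ₗ[A] N, ∀ x, x - j (r x) ∈ h.radical := by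
  have hinj : Function.Injective (h.radical.mkQ ∘ₗ j) := by
    rw [injective_iff_map_eq_zero]
    exact fun y hy => hj y (by simpa using hy)
  obtain ⟨r', hr'⟩ := Module.Injective.out (h.radical.mkQ ∘ₗ j) hinj LinearMap.id
  obtain ⟨r, hrj, hrK⟩ : ∃ r : M →ₗ[A] N, (∀ y, r (j y) = y) ∧ ∀ x ∈ h.radical, r x = 0 :=
    ⟨r' ∘ₗ h.radical.mkQ, hr', fun x hx => by
      rw [LinearMap.comp_apply, Submodule.mkQ_apply, (Submodule.Quotient.mk_eq_zero _).mpr hx,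
        _root_.map_zero]⟩
  refine ⟨r, fun x => ?_⟩
  by_contra hx
  obtain ⟨a, ha, hma⟩ := h.exists_smul_notMem_radical hx (hχ _)
  set y := a • (x - j (r x)) with hy
  have hry : r y = 0 := by simp [hy, hrj]
  let c := χ y / χ (j y₀)
  have hz : y - j (σ c • y₀) ∈ h.radical := by
    refine h.mem_radical_of_apply_eq_zero hσ ?_ fun b hb => ?_
    · rw [h.map_sub, _root_.map_smul, h.2, div_mul_cancel₀ _ hjy₀, sub_self]
    · rw [smul_sub, ← _root_.map_smul, smul_comm b (σ c), hy₀ b hb, smul_zero, _root_.map_zero, sub_zero]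
      exact hma b hb
  have hc := hrK _ hz
  rw [_root_.map_sub, hry, hrj, zero_sub, neg_eq_zero] at hc
  rw [hc, _root_.map_zero, sub_zero] at hz
  exact ha hz

end IsSigmaLinear

/-- A nonzero vector takes the value `1` under some `k`-linear form. -/
lemma exists_isSigmaLinear_apply_eq_one {k A M : Type} [Field k] [CommRing A] [AddCommGroup M]
    [Module A M] (σ : k →+* A) {x : M} (hx : x ≠ 0) :
    ∃ p : M → k, IsSigmaLinear σ p ∧ p x = 1 := by
  let : Module k M := Module.compHom M σ
  obtain ⟨g, hg⟩ := (LinearMap.toSpanSingleton k M x).exists_leftInverse_of_injective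
    (LinearMap.ker_toSpanSingleton k hx)
  exact ⟨g, ⟨g.map_add, g.map_smul⟩, by simpa using LinearMap.congr_fun hg 1⟩

/-- Over a Noetherian local ring, a finitely generated module with an essential submodule
killed by the maximal ideal `m` is killed by a power of `m`. -/
lemma exists_maximalIdeal_pow_smul_eq_bot {A E : Type} [CommRing A] [IsNoetherianRing A]
    [IsLocalRing A] [AddCommGroup E] [Module A E] {V : Submodule A E}
    (hV : IsLocalRing.maximalIdeal A • V = ⊥) (hess : ∀ N : Submodule A E, N ≠ ⊥ → N ⊓ V ≠ ⊥)
    {N : Submodule A E} (hN : N.FG) : ∃ s : ℕ, IsLocalRing.maximalIdeal A ^ s • N = ⊥ := by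
  have : Module.Finite A N := Module.Finite.iff_fg.mpr hN
  obtain ⟨s, hs⟩ := (IsLocalRing.maximalIdeal A).exists_pow_inf_eq_pow_smul (V.comap N.subtype)
  refine ⟨s + 1, by_contra fun hne => hess _ hne ?_⟩
  have h1 := congrArg (Submodule.map N.subtype) (hs (s + 1) s.le_succ)
  rw [Submodule.map_inf _ N.injective_subtype, Submodule.map_smul'', Submodule.map_top,
    Submodule.range_subtype, Submodule.map_comap_subtype, Nat.add_sub_cancel_left, pow_one,
    Submodule.map_smul''] at h1
  rw [eq_bot_iff]
  calc _ ≤ IsLocalRing.maximalIdeal A ^ (s + 1) • N ⊓ (N ⊓ V) :=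
        le_inf inf_le_left (le_inf (inf_le_left.trans Submodule.smul_le_right) inf_le_right)
    _ ≤ IsLocalRing.maximalIdeal A • V := by
        rw [h1]
        exact Submodule.smul_mono le_rfl (Submodule.map_le_iff_le_comap.mpr inf_le_right)
    _ = ⊥ := hV

lemma IsContinuousLinearForm.exists_pow_smul_apply_eq_zero {k A M : Type} [Zero k] [CommRing A]
    [IsLocalRing A] [AddCommGroup M] [Module A M] {ψ : M → k} (h : IsContinuousLinearForm A ψ)
    (x : M) : ∃ s : ℕ, ∀ a ∈ IsLocalRing.maximalIdeal A ^ s, ψ (a • x) = 0 := by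
  obtain ⟨s, hs⟩ := h _ (Submodule.fg_span_singleton x)
  exact ⟨s, fun a ha => hs _ (Submodule.smul_mem_smul ha (Submodule.mem_span_singleton_self x))⟩

/-- Let `(A, m)` be a commutative Noetherian local ring containing a field `k` mapping
isomorphically onto its residue field, and let `E` be an injective hull of `k` over `A`.
Then for any `A`-module `M`, the Matlis dual `Hom_A(M, E)` is in `k`-linear bijection with
the `k`-vector space of continuous `k`-linear maps from `M` to `k`. -/
theorem matlisDual_equiv_continuousDual
    {k A : Type} [Field k] [CommRing A] [IsNoetherianRing A] [IsLocalRing A]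
    (σ : k →+* A)
    (hres : Function.Bijective ((Ideal.Quotient.mk (IsLocalRing.maximalIdeal A)).comp σ))
    (E : Type) [AddCommGroup E] [Module A E] [Module.Injective A E]
    (ι : (A ⧸ IsLocalRing.maximalIdeal A) →ₗ[A] E) (hι : Function.Injective ι)
    (hess : ∀ N : Submodule A E, N ≠ ⊥ → N ⊓ LinearMap.range ι ≠ ⊥)
    (M : Type) [AddCommGroup M] [Module A M] :
    ∃ Λ : (M →ₗ[A] E) → (M → k),
      (∀ φ, IsSigmaLinear σ (Λ φ) ∧ IsContinuousLinearForm A (Λ φ)) ∧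
      (∀ φ₁ φ₂ : M →ₗ[A] E, Λ (φ₁ + φ₂) = fun x => Λ φ₁ x + Λ φ₂ x) ∧
      (∀ (c : k) (φ : M →ₗ[A] E), Λ (σ c • φ) = fun x => c * Λ φ x) ∧
      Function.Injective Λ ∧
      (∀ ψ : M → k, IsSigmaLinear σ ψ → IsContinuousLinearForm A ψ → ∃ φ, Λ φ = ψ) := by
  have hm_mk : ∀ b ∈ IsLocalRing.maximalIdeal A, ∀ t : A ⧸ IsLocalRing.maximalIdeal A,
      b • t = 0 := by
    intro b hb t
    rw [Algebra.smul_def, Ideal.Quotient.algebraMap_eq, Ideal.Quotient.eq_zero_iff_mem.mpr hb,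
      zero_mul]
  have hV : IsLocalRing.maximalIdeal A • LinearMap.range ι = ⊥ := by
    rw [eq_bot_iff, Submodule.smul_le]
    rintro b hb _ ⟨t, rfl⟩
    rw [← map_smul, hm_mk b hb, map_zero]
    exact zero_mem _
  have htors := fun N hN => exists_maximalIdeal_pow_smul_eq_bot hV hess (N := N) hN
  obtain ⟨p, hp, hp1⟩ := exists_isSigmaLinear_apply_eq_one σ
    ((map_ne_zero_iff ι hι).mpr one_ne_zero)
  have hpN : ∀ N : Submodule A E, (∀ x ∈ N, p x = 0) → N = ⊥ := by
    intro N hN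
    by_contra hne
    refine hess N hne (eq_bot_iff.mpr ?_)
    rintro _ ⟨hx, t, rfl⟩
    obtain ⟨c, rfl⟩ := hres.2 t
    have hc : ι ((Ideal.Quotient.mk (IsLocalRing.maximalIdeal A)).comp σ c) = σ c • ι 1 := by
      rw [← map_smul, Algebra.smul_def, mul_one]
      rfl
    have h0 := hN _ hx
    rw [hc, hp.2, hp1, mul_one] at h0
    rw [hc, h0, map_zero, zero_smul]
    exact zero_mem _
  have hpcont : IsContinuousLinearForm A p := by
    intro N hN
    obtain ⟨s, hs⟩ := htors N hN
    refine ⟨s, fun x hx => ?_⟩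
    rw [hs, Submodule.mem_bot] at hx
    rw [hx, hp.map_zero]
  refine ⟨fun φ x => p (φ x), fun φ => ⟨hp.comp φ, fun N hN => ?_⟩, fun φ₁ φ₂ => ?_,
    fun c φ => ?_, fun φ₁ φ₂ h => ?_, fun ψ hψ hψc => ?_⟩
  · obtain ⟨s, hs⟩ := hpcont _ (hN.map φ)
    refine ⟨s, fun x hx => hs _ ?_⟩
    rw [← Submodule.map_smul'']
    exact Submodule.mem_map_of_mem hx
  · exact funext fun x => hp.1 _ _
  · exact funext fun x => hp.2 _ _
  · rw [← sub_eq_zero, ← LinearMap.range_eq_bot]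
    refine hpN _ ?_
    rintro _ ⟨x, rfl⟩
    rw [LinearMap.sub_apply, hp.map_sub, sub_eq_zero]
    exact congrFun h x
  · have hχ : IsSigmaLinear σ fun q : E × M => p q.1 + ψ q.2 :=
      ⟨fun x y => by simp only [Prod.fst_add, Prod.snd_add, hp.1, hψ.1]; ring,
        fun c x => by simp only [Prod.smul_fst, Prod.smul_snd, hp.2, hψ.2]; ring⟩
    have hχc : ∀ q : E × M, ∃ s : ℕ, ∀ a ∈ IsLocalRing.maximalIdeal A ^ s,
        p (a • q).1 + ψ (a • q).2 = 0 := by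
      intro q
      obtain ⟨s, hs⟩ := hpcont.exists_pow_smul_apply_eq_zero q.1
      obtain ⟨t, ht⟩ := hψc.exists_pow_smul_apply_eq_zero q.2
      refine ⟨s + t, fun a ha => ?_⟩
      rw [Prod.smul_fst, Prod.smul_snd, hs a (Ideal.pow_le_pow_right (Nat.le_add_right s t) ha),
        ht a (Ideal.pow_le_pow_right (Nat.le_add_left t s) ha), add_zero]
    have hinl : ∀ e, LinearMap.inl A E M e ∈ hχ.radical → e = 0 := by
      intro e he
      rw [← Submodule.span_singleton_eq_bot (R := A)]
      refine hpN _ fun x hx => ?_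
      obtain ⟨a, rfl⟩ := Submodule.mem_span_singleton.mp hx
      simpa [hψ.map_zero] using he a
    obtain ⟨r, hr⟩ := hχ.exists_sub_mem_radical hres.2 hχc (LinearMap.inl A E M) hinl (ι 1)
      (fun b hb => by rw [← map_smul, hm_mk b hb, map_zero]) (by simp [hp1, hψ.map_zero])
    refine ⟨r ∘ₗ LinearMap.inr A E M, funext fun x => ?_⟩
    have hx := hr (0, x) 1
    simp only [one_smul, LinearMap.inl_apply, Prod.mk_sub_mk, sub_zero, hp.map_sub,
      hp.map_zero] at hx
    rw [zero_sub, neg_add_eq_zero] at hx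
    exact hx
end

section
/- Let k be a field of characteristic zero, A = k[x_1, …, x_n], and m = (x_1, …, x_n). Let M and E be A-modules equipped with connections (D_1^M, …, D_n^M) and (D_1^E, …, D_n^E) respectively. Assume: (i) every element of E is annihilated by some power of m; and (ii) whenever an element e of the subgroup D_1^E(E) + ⋯ + D_n^E(E) satisfies x_j·e = 0 for all j = 1, …, n, then e = 0. Let φ : M → E be an A-linear map with φ(D_1^M(M) + ⋯ + D_n^M(M)) ⊆ D_1^E(E) + ⋯ + D_n^E(E). Then φ commutes with the connections: φ(D_i^M(m)) = D_i^E(φ(m)) for all i and all m ∈ M. -/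
/-- A submodule of a module all of whose elements are annihilated by powers of
`(x_j)_j` vanishes as soon as it contains no nonzero element killed by all the `x_j`. -/
theorem Submodule.eq_zero_of_forall_pow_span_range_smul_eq_zero {R E ι : Type*} [CommRing R]
    [AddCommGroup E] [Module R E] (r : ι → R) (N : Submodule R E)
    (hN : ∀ e ∈ N, (∀ j, r j • e = 0) → e = 0) (s : ℕ) :
    ∀ e ∈ N, (∀ a ∈ Ideal.span (Set.range r) ^ s, a • e = 0) → e = 0 := by
  induction s with
  | zero => exact fun e _ h => by simpa using h 1 (by simp)
  | succ s ih =>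
    refine fun e he h => hN e he fun j => ih _ (N.smul_mem _ he) fun a ha => ?_
    rw [smul_smul]
    exact h _ (pow_succ (Ideal.span (Set.range r)) s ▸
      Ideal.mul_mem_mul ha (Ideal.subset_span ⟨j, rfl⟩))


/-- Let `k` have characteristic zero, `A = k[x_1, …, x_n]`, `m = (x_1, …, x_n)`.
Let `M`, `E` be `A`-modules with connections `D^M`, `D^E`.  If every element of `E` is
annihilated by a power of `m`, and no nonzero element of `D_1^E(E) + ⋯ + D_n^E(E)` is killed
by all the `x_j`, then any `A`-linear `φ : M → E` carrying `∑ D_i^M(M)` into `∑ D_i^E(E)`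
commutes with the connections. -/
theorem linearMap_commutes_with_connections
    {k : Type} [Field k] [CharZero k] {n : ℕ}
    {M E : Type} [AddCommGroup M] [Module (MvPolynomial (Fin n) k) M]
    [AddCommGroup E] [Module (MvPolynomial (Fin n) k) E]
    (DM : Fin n → M →+ M) (DE : Fin n → E →+ E)
    (hDM : ∀ (i : Fin n) (a : MvPolynomial (Fin n) k) (x : M),
      DM i (a • x) = (MvPolynomial.pderiv i a) • x + a • DM i x)
    (hDE : ∀ (i : Fin n) (a : MvPolynomial (Fin n) k) (e : E),
      DE i (a • e) = (MvPolynomial.pderiv i a) • e + a • DE i e)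
    (htors : ∀ e : E, ∃ s : ℕ, ∀ a ∈ (Ideal.span
        (Set.range (MvPolynomial.X : Fin n → MvPolynomial (Fin n) k))) ^ s, a • e = 0)
    (hreg : ∀ e ∈ (⨆ i : Fin n, (DE i).range : AddSubgroup E),
      (∀ j : Fin n, (MvPolynomial.X j : MvPolynomial (Fin n) k) • e = 0) → e = 0)
    (φ : M →ₗ[MvPolynomial (Fin n) k] E)
    (hφ : ∀ x ∈ (⨆ i : Fin n, (DM i).range : AddSubgroup M),
      φ x ∈ (⨆ i : Fin n, (DE i).range : AddSubgroup E))
    (i : Fin n) (x : M) :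
    φ (DM i x) = DE i (φ x) := by
  let ψ : M →ₗ[MvPolynomial (Fin n) k] E :=
    { toFun := fun y => φ (DM i y) - DE i (φ y)
      map_add' := fun y z => by simp only [map_add]; abel
      map_smul' := fun a y => by
        simp only [hDM, hDE, map_add, map_smul, RingHom.id_apply, smul_sub]; abel }
  have hψ : ∀ e ∈ LinearMap.range ψ, e ∈ (⨆ i : Fin n, (DE i).range : AddSubgroup E) := by
    rintro _ ⟨y, rfl⟩
    exact sub_mem (hφ _ (AddSubgroup.mem_iSup_of_mem i ⟨y, rfl⟩))
      (AddSubgroup.mem_iSup_of_mem i ⟨φ y, rfl⟩)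
  obtain ⟨s, hs⟩ := htors (ψ x)
  exact sub_eq_zero.mp (Submodule.eq_zero_of_forall_pow_span_range_smul_eq_zero MvPolynomial.X
    (LinearMap.range ψ) (fun e he => hreg e (hψ e he)) s (ψ x) ⟨x, rfl⟩ hs)
end

section
/- For every natural number i, all elements f, g ∈ A, and every m ∈ M, there exists an element m' ∈ M such that (−1)^i·f·D^i(g·m) = (g·∂^i(f))·m + D(m'), where D^i and ∂^i denote the i-fold iterates of D and ∂. -/
/-- Iterated integration by parts: `(-1)^i f • D^i y` and `∂^i f • y` agree up to the image
of `D`. -/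
theorem exists_iterate_smul_eq_add_map
    {A M : Type*} [CommRing A] [AddCommGroup M] [Module A M]
    (d : A →+ A) (D : M →+ M) (hD : ∀ (a : A) (x : M), D (a • x) = d a • x + a • D x)
    (i : ℕ) (f : A) (y : M) :
    ∃ x' : M, ((-1 : A) ^ i * f) • (⇑D)^[i] y = (⇑d)^[i] f • y + D x' := by
  induction i generalizing y with
  | zero => exact ⟨0, by simp⟩
  | succ i ih =>
    obtain ⟨x', hx'⟩ := ih (D y)
    refine ⟨-((⇑d)^[i] f • y) - x', ?_⟩
    rw [Function.iterate_succ_apply, Function.iterate_succ_apply', pow_succ', neg_one_mul,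
      neg_mul, neg_smul, hx', map_sub, map_neg, hD]
    abel


/-- Let `A` be a commutative ring with a derivation `∂` and `M` an `A`-module with an additive
map `D` satisfying the Leibniz rule.  For every `i`, `f, g ∈ A` and `m ∈ M` there is `m' ∈ M`
with `(−1)^i f·D^i(g·m) = (g·∂^i(f))·m + D(m')`. -/
theorem exists_commutation_remainder
    {A M : Type} [CommRing A] [AddCommGroup M] [Module A M]
    (d : A →+ A) (hd : ∀ a b : A, d (a * b) = d a * b + a * d b)
    (D : M →+ M) (hD : ∀ (a : A) (x : M), D (a • x) = d a • x + a • D x)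
    (i : ℕ) (f g : A) (x : M) :
    ∃ x' : M, ((-1 : A) ^ i * f) • (⇑D)^[i] (g • x) = (g * (⇑d)^[i] f) • x + D x' := by
  obtain ⟨x', hx'⟩ := exists_iterate_smul_eq_add_map d D hD i f (g • x)
  exact ⟨x', by rw [hx', smul_smul, mul_comm]⟩
end

section
/- Let e ∈ M and let a_0, …, a_r ∈ A be elements satisfying Σ_{i=0}^r (−1)^i·D^i(a_i·e) = 0, where D^i denotes the i-fold iterate of D. Then for every b ∈ A, the element (Σ_{i=0}^r a_i·∂^i(b))·e lies in the image D(M) of D. -/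
/-- Iterated integration by parts: moving `d^i` from the scalar to the vector as `(-1)^i D^i`
changes `d^i b • x` only by an element of the image of `D`. -/
theorem iterate_smul_sub_smul_iterate_mem_range
    {A M : Type*} [CommRing A] [AddCommGroup M] [Module A M]
    (d : A →+ A) (D : M →+ M) (hD : ∀ (a : A) (x : M), D (a • x) = d a • x + a • D x)
    (b : A) (i : ℕ) (x : M) :
    (⇑d)^[i] b • x - b • ((-1 : A) ^ i • (⇑D)^[i] x) ∈ D.range := by
  induction i generalizing x with
  | zero => simp
  | succ i ih =>
    have h := D.range.sub_mem ⟨(⇑d)^[i] b • x, rfl⟩ (ih (D x))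
    rw [hD] at h
    convert h using 1
    rw [Function.iterate_succ_apply', Function.iterate_succ_apply, pow_succ]
    module

/-- Let `A` be a commutative ring with a derivation `∂` and `M` an `A`-module with an additive
map `D` satisfying the Leibniz rule.  If `e ∈ M` and `a_0, …, a_r ∈ A` satisfy
`Σ_{i=0}^r (−1)^i D^i(a_i e) = 0`, then for every `b ∈ A` the element
`(Σ_{i=0}^r a_i ∂^i(b))·e` lies in the image of `D`. -/
theorem smul_mem_image_of_diffOp_annihilates
    {A M : Type} [CommRing A] [AddCommGroup M] [Module A M]
    (d : A →+ A) (hd : ∀ a b : A, d (a * b) = d a * b + a * d b)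
    (D : M →+ M) (hD : ∀ (a : A) (x : M), D (a • x) = d a • x + a • D x)
    (r : ℕ) (a : ℕ → A) (e : M)
    (ha : ∑ i ∈ Finset.range (r + 1), ((-1 : A) ^ i) • (⇑D)^[i] (a i • e) = 0)
    (b : A) :
    ∃ x' : M, (∑ i ∈ Finset.range (r + 1), a i * (⇑d)^[i] b) • e = D x' := by
  have h := D.range.sum_mem (t := Finset.range (r + 1)) fun i _ =>
    iterate_smul_sub_smul_iterate_mem_range d D hD b i (a i • e)
  rw [Finset.sum_sub_distrib, ← Finset.smul_sum, ha, smul_zero, sub_zero] at h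
  obtain ⟨x', hx'⟩ := h
  refine ⟨x', ?_⟩
  rw [hx', Finset.sum_smul]
  exact Finset.sum_congr rfl fun i _ => by rw [smul_smul, mul_comm]
end

section
/- Let k be a field of characteristic zero. The k-linear endomorphism D of the polynomial ring k[x] defined by D(f) = f' + x²·f, where f' is the formal derivative, is injective, and the quotient k-vector space k[x]/D(k[x]) has dimension 2 over k. -/
namespace Polynomial

variable {k : Type*} [Field k] {q : k[X]} {D : k[X] →ₗ[k] k[X]}

theorem degree_derivative_add_mul (hq : q ≠ 0) {f : k[X]} (hf : f ≠ 0) :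
    (derivative f + q * f).degree = q.degree + f.degree := by
  rw [degree_add_eq_right_of_degree_lt, degree_mul]
  exact (degree_derivative_lt hf).trans_le (degree_le_mul_left f hq |>.trans_eq (by rw [mul_comm]))

theorem injective_of_eq_derivative_add_mul (hq : q ≠ 0)
    (hD : ∀ f, D f = derivative f + q * f) : Function.Injective D := by
  rw [injective_iff_map_eq_zero]
  intro f hf
  by_contra h
  have hdeg := degree_derivative_add_mul hq h
  rw [← hD, hf, degree_zero, eq_comm, WithBot.add_eq_bot, degree_eq_bot, degree_eq_bot] at hdeg
  exact hdeg.elim hq h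

theorem mem_range_sup_degreeLT (hq : q ≠ 0) (hD : ∀ f, D f = derivative f + q * f) (p : k[X]) :
    p ∈ LinearMap.range D ⊔ degreeLT k q.natDegree := by
  induction hp : p.degree using WellFoundedLT.induction generalizing p with
  | _ d ih =>
    have hr : p % q ∈ degreeLT k q.natDegree := by
      rw [mem_degreeLT, ← degree_eq_natDegree hq]
      exact degree_mod_lt p hq
    have hs : derivative (p / q) ∈ LinearMap.range D ⊔ degreeLT k q.natDegree := by
      by_cases h : p / q = 0
      · simp [h]
      · exact ih _ (hp ▸ (degree_derivative_lt h).trans_le (degree_div_le p q)) _ rfl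
    have hdecomp : p = D (p / q) + p % q - derivative (p / q) := by
      rw [hD]
      linear_combination -EuclideanDomain.div_add_mod p q
    rw [hdecomp]
    exact sub_mem (add_mem (Submodule.mem_sup_left ⟨_, rfl⟩) (Submodule.mem_sup_right hr)) hs

theorem isCompl_range_degreeLT (hq : q ≠ 0) (hD : ∀ f, D f = derivative f + q * f) :
    IsCompl (LinearMap.range D) (degreeLT k q.natDegree) := by
  refine ⟨?_, codisjoint_iff.mpr (eq_top_iff.mpr fun p _ => mem_range_sup_degreeLT hq hD p)⟩
  rw [Submodule.disjoint_def]
  rintro _ ⟨f, rfl⟩ hf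
  by_contra h
  have hf0 : f ≠ 0 := by
    rintro rfl
    exact h (map_zero D)
  rw [mem_degreeLT, ← degree_eq_natDegree hq, hD, degree_derivative_add_mul hq hf0,
    degree_eq_natDegree hq, degree_eq_natDegree hf0] at hf
  norm_cast at hf
  omega

theorem finrank_quotient_range_of_eq_derivative_add_mul (hq : q ≠ 0)
    (hD : ∀ f, D f = derivative f + q * f) :
    Module.finrank k (k[X] ⧸ LinearMap.range D) = q.natDegree := by
  rw [(Submodule.quotientEquivOfIsCompl _ _ (isCompl_range_degreeLT hq hD)).finrank_eq,
    (degreeLTEquiv k q.natDegree).finrank_eq, Module.finrank_fin_fun]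

end Polynomial

/-- Over a field `k` of characteristic zero, the `k`-linear endomorphism
`D(f) = f' + x²·f` of `k[x]` is injective, and `k[x]/D(k[x])` is 2-dimensional over `k`. -/
theorem polynomial_twisted_derivative_injective_and_coker_two_dimensional
    {k : Type} [Field k] [CharZero k]
    (D : Polynomial k →ₗ[k] Polynomial k)
    (hD : ∀ f : Polynomial k, D f = Polynomial.derivative f + Polynomial.X ^ 2 * f) :
    Function.Injective D ∧
      Module.finrank k (Polynomial k ⧸ LinearMap.range D) = 2 := by
  have hq : (Polynomial.X ^ 2 : Polynomial k) ≠ 0 := pow_ne_zero 2 Polynomial.X_ne_zero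
  refine ⟨Polynomial.injective_of_eq_derivative_add_mul hq hD, ?_⟩
  rw [Polynomial.finrank_quotient_range_of_eq_derivative_add_mul hq hD,
    Polynomial.natDegree_X_pow]
end

section
/- Let M be an A-module equipped with a connection (D_1, …, D_n), and let m ∈ M be a nonzero element with D_i(m) = 0 for all i = 1, …, n. Then the A-linear map A → M defined by a ↦ a·m is injective; in particular, the annihilator of m in A is zero. -/
namespace MvPolynomial

/-- In characteristic zero, a polynomial all of whose partial derivatives vanish is constant. -/
theorem eq_C_of_forall_pderiv_eq_zero {R σ : Type*} [CommSemiring R] [NoZeroDivisors R]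
    [CharZero R] {a : MvPolynomial σ R} (h : ∀ i, pderiv i a = 0) :
    a = C (coeff 0 a) := by
  classical
  ext d
  rw [coeff_C]
  split_ifs with hd
  · rw [hd]
  · obtain ⟨i, hi⟩ := Finsupp.ne_iff.mp (Ne.symm hd)
    have hle : Finsupp.single i 1 ≤ d := by
      simpa [Finsupp.single_le_iff, Nat.one_le_iff_ne_zero] using hi
    have hc := congrArg (coeff (d - Finsupp.single i 1)) (h i)
    rw [coeff_pderiv, tsub_add_cancel_of_le hle, coeff_zero] at hc
    exact (mul_eq_zero.mp hc).resolve_right (Nat.cast_add_one_ne_zero _)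

/-- In characteristic zero, an element of a set stable under all partial derivatives that
contains no nonzero constant is zero. -/
theorem eq_zero_of_mem_of_pderiv_mem {R σ : Type*} [CommSemiring R] [NoZeroDivisors R]
    [CharZero R] {S : Set (MvPolynomial σ R)} (hS : ∀ i, ∀ a ∈ S, pderiv i a ∈ S)
    (hC : ∀ c : R, C c ∈ S → c = 0) {a : MvPolynomial σ R} (ha : a ∈ S) : a = 0 := by
  suffices H : ∀ (N : ℕ) (a : MvPolynomial σ R), a ∈ S →
      (∀ d, coeff d a ≠ 0 → d.degree < N) → a = 0 from
    H (a.totalDegree + 1) a ha fun d hd =>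
      Nat.lt_succ_of_le (le_totalDegree (mem_support_iff.mpr hd))
  intro N
  induction N with
  | zero =>
    intro a _ h
    ext d
    by_contra hd
    exact Nat.not_lt_zero _ (h d hd)
  | succ N ih =>
    intro a ha h
    have hconst : a = C (coeff 0 a) := eq_C_of_forall_pderiv_eq_zero fun i => by
      refine ih _ (hS i a ha) fun d hd => ?_
      rw [coeff_pderiv] at hd
      have := h _ (left_ne_zero_of_mul hd)
      rw [map_add, Finsupp.degree_single] at this
      exact Nat.lt_of_succ_lt_succ this
    rw [hconst] at ha ⊢
    rw [hC _ ha, C_0]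

end MvPolynomial

/-- Let `k` have characteristic zero, `A = k[x_1, …, x_n]` and `M` an `A`-module with a
connection `(D_1, …, D_n)`.  If `x ∈ M` is nonzero and horizontal (`D_i x = 0` for all `i`),
then `a ↦ a • x` is injective; in particular the annihilator of `x` in `A` is zero. -/
theorem smul_injective_of_horizontal
    {k : Type} [Field k] [CharZero k] {n : ℕ}
    {M : Type} [AddCommGroup M] [Module (MvPolynomial (Fin n) k) M]
    (D : Fin n → M →+ M)
    (hD : ∀ (i : Fin n) (a : MvPolynomial (Fin n) k) (x : M),
      D i (a • x) = (MvPolynomial.pderiv i a) • x + a • D i x)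
    (x : M) (hx : x ≠ 0) (hDx : ∀ i : Fin n, D i x = 0) :
    Function.Injective (fun a : MvPolynomial (Fin n) k => a • x) ∧
      ∀ a : MvPolynomial (Fin n) k, a • x = 0 → a = 0 := by
  have hann : ∀ a : MvPolynomial (Fin n) k, a • x = 0 → a = 0 := by
    intro a ha
    refine MvPolynomial.eq_zero_of_mem_of_pderiv_mem (S := {a | a • x = 0})
      (fun i a (ha : a • x = 0) => ?_) (fun c hc => ?_) ha
    · have h := hD i a x
      rw [ha, map_zero, hDx, smul_zero, add_zero] at h
      exact h.symm
    · by_contra hc0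
      have hu : IsUnit (MvPolynomial.C c : MvPolynomial (Fin n) k) :=
        (isUnit_iff_ne_zero.mpr hc0).map MvPolynomial.C
      exact hx (hu.smul_eq_zero.mp hc)
  refine ⟨fun a b hab => sub_eq_zero.mp (hann _ ?_), hann⟩
  rw [sub_smul]
  exact sub_eq_zero.mpr hab
end
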